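/- For every C > 0 there exists a constant c > 0 such that the following holds for all n ≥ 2. Let V = [n] with strictly positive vertex weights μ satisfying μ_i/μ(V) ≥ n^{−C} for all i, and let {v_i}_{i∈V} ⊆ ℝ^d satisfy ∑_{i∈V} μ_i v_i = 0 and ∑_{i∈V} μ_i ‖v_i‖² = 1 (so Var_μ(v) = 1/μ(V)). Define R_t = {i ∈ V : ‖v_i‖² ≤ t/μ(V)}. If the embedding is not (3, 1/10)-balanced, then there exists t ≥ 3 such that S = V \ R_t is (c/log n, 1/3)-robustly separated with respect to {v_i}, witnessed by T = R_{3/2}. -/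

import Mathlib

open Finset
open scoped Classical

lemma variance_identity {ι : Type*} {d : ℕ} (A : Finset ι) (μ : ι → ℝ)
    (v : ι → EuclideanSpace ℝ (Fin d)) :
    ∑ i ∈ A, ∑ j ∈ A, μ i * μ j * ‖v i - v j‖ ^ 2 =
      2 * ((∑ i ∈ A, μ i) * (∑ i ∈ A, μ i * ‖v i‖ ^ 2) - ‖∑ i ∈ A, μ i • v i‖ ^ 2) := by
  have h1 : ‖∑ i ∈ A, μ i • v i‖ ^ 2 =
      ∑ i ∈ A, ∑ j ∈ A, μ i * μ j * inner ℝ (v i) (v j) := by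
    rw [← real_inner_self_eq_norm_sq, sum_inner]
    refine Finset.sum_congr rfl fun i _ => ?_
    rw [inner_sum]
    refine Finset.sum_congr rfl fun j _ => ?_
    rw [real_inner_smul_left, real_inner_smul_right]; ring
  have h2 : (∑ i ∈ A, μ i) * (∑ i ∈ A, μ i * ‖v i‖ ^ 2) =
      ∑ i ∈ A, ∑ j ∈ A, μ i * μ j * ‖v j‖ ^ 2 := by
    rw [Finset.sum_mul_sum]
    exact Finset.sum_congr rfl fun i _ => Finset.sum_congr rfl fun j _ => by ring
  have h3 : (∑ i ∈ A, μ i) * (∑ i ∈ A, μ i * ‖v i‖ ^ 2) =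
      ∑ i ∈ A, ∑ j ∈ A, μ i * μ j * ‖v i‖ ^ 2 := by
    rw [h2, Finset.sum_comm]
    exact Finset.sum_congr rfl fun i _ => Finset.sum_congr rfl fun j _ => by ring
  have h4 : ∑ i ∈ A, ∑ j ∈ A, μ i * μ j * ‖v i - v j‖ ^ 2 =
      ∑ i ∈ A, ∑ j ∈ A, μ i * μ j * ‖v i‖ ^ 2 + ∑ i ∈ A, ∑ j ∈ A, μ i * μ j * ‖v j‖ ^ 2
       - 2 * ∑ i ∈ A, ∑ j ∈ A, μ i * μ j * inner ℝ (v i) (v j) := by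
    simp only [Finset.mul_sum, ← Finset.sum_add_distrib, ← Finset.sum_sub_distrib]
    refine Finset.sum_congr rfl fun i _ => Finset.sum_congr rfl fun j _ => ?_
    rw [norm_sub_sq_real]; ring
  rw [h4, ← h1, ← h2, ← h3]; ring

lemma dyadic_bound (a x : ℝ) (ha : 0 < a) (hx : a < x) (L : ℕ) (hL : x ≤ a * 2 ^ L) :
    x ≤ ∑ k ∈ range L, if a * 2 ^ k < x then 2 * (a * 2 ^ k) else 0 := by
  induction L with
  | zero => simp at hL; linarith
  | succ L ih =>
    rw [Finset.sum_range_succ]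
    by_cases h : a * 2 ^ L < x
    · rw [if_pos h]
      have : 0 ≤ ∑ k ∈ range L, if a * 2 ^ k < x then 2 * (a * 2 ^ k) else 0 :=
        Finset.sum_nonneg fun k _ => by split_ifs <;> positivity
      rw [pow_succ] at hL; linarith
    · rw [if_neg h, add_zero]; exact ih (not_lt.mp h)

lemma markov_weight {n d : ℕ} (μ : Fin n → ℝ) (v : Fin n → EuclideanSpace ℝ (Fin d))
    (hμ : ∀ i, 0 < μ i) (h1 : (∑ i, μ i * ‖v i‖ ^ 2) = 1) (s : ℝ) :
    s * (∑ i ∈ univ.filter (fun i => ¬ ‖v i‖ ^ 2 ≤ s), μ i) ≤ 1 := by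
  rw [← h1, Finset.mul_sum]
  refine le_trans (Finset.sum_le_sum (g := fun i => μ i * ‖v i‖ ^ 2) fun i hi => ?_)
    (Finset.sum_le_sum_of_subset_of_nonneg (Finset.filter_subset _ _)
      fun i _ _ => mul_nonneg (hμ i).le (sq_nonneg _))
  have := not_le.mp (Finset.mem_filter.mp hi).2
  nlinarith [hμ i]

lemma tail_half {n d : ℕ} (μ : Fin n → ℝ) (v : Fin n → EuclideanSpace ℝ (Fin d))
    (hμ : ∀ i, 0 < μ i) (M : ℝ) (hM : M = ∑ j, μ j) (hM0 : 0 < M)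
    (h0 : (∑ i, μ i • v i) = 0) (h1 : (∑ i, μ i * ‖v i‖ ^ 2) = 1)
    (hb : ∑ i ∈ univ.filter (fun i => ‖v i‖ ^ 2 ≤ 3 / M),
      ∑ j ∈ univ.filter (fun i => ‖v i‖ ^ 2 ≤ 3 / M), μ i * μ j * ‖v i - v j‖ ^ 2 < M / 5) :
    1 / 2 ≤ ∑ i ∈ univ.filter (fun i => ¬ ‖v i‖ ^ 2 ≤ 3 / M), μ i * ‖v i‖ ^ 2 := by
  have e0 := Finset.sum_filter_add_sum_filter_not univ (fun i => ‖v i‖ ^ 2 ≤ 3 / M)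
    (fun i => μ i • v i)
  have e1 := Finset.sum_filter_add_sum_filter_not univ (fun i => ‖v i‖ ^ 2 ≤ 3 / M)
    (fun i => μ i * ‖v i‖ ^ 2)
  have e2 := Finset.sum_filter_add_sum_filter_not univ (fun i => ‖v i‖ ^ 2 ≤ 3 / M) μ
  have hmk := markov_weight μ v hμ h1 (3 / M)
  have hB := variance_identity (univ.filter (fun i => ¬ ‖v i‖ ^ 2 ≤ 3 / M)) μ v
  have hBn : 0 ≤ ∑ i ∈ univ.filter (fun i => ¬ ‖v i‖ ^ 2 ≤ 3 / M),
      ∑ j ∈ univ.filter (fun i => ¬ ‖v i‖ ^ 2 ≤ 3 / M), μ i * μ j * ‖v i - v j‖ ^ 2 :=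
    Finset.sum_nonneg fun i _ => Finset.sum_nonneg fun j _ =>
      mul_nonneg (mul_pos (hμ i) (hμ j)).le (sq_nonneg _)
  rw [variance_identity] at hb
  rw [h0] at e0
  rw [h1] at e1
  rw [← hM] at e2
  rw [eq_neg_of_add_eq_zero_left e0, norm_neg] at hb
  rw [div_mul_eq_mul_div, div_le_one hM0] at hmk
  generalize (∑ i ∈ univ.filter (fun i => ¬ ‖v i‖ ^ 2 ≤ 3 / M), μ i * ‖v i‖ ^ 2) = q at *
  generalize (∑ i ∈ univ.filter (fun i => ‖v i‖ ^ 2 ≤ 3 / M), μ i * ‖v i‖ ^ 2) = s at *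
  generalize (∑ i ∈ univ.filter (fun i => ¬ ‖v i‖ ^ 2 ≤ 3 / M), μ i) = r at *
  generalize (∑ i ∈ univ.filter (fun i => ‖v i‖ ^ 2 ≤ 3 / M), μ i) = m at *
  generalize ‖∑ i ∈ univ.filter (fun i => ¬ ‖v i‖ ^ 2 ≤ 3 / M), μ i • v i‖ ^ 2 = w at *
  have hs : s = 1 - q := by linarith
  have hm : m = M - r := by linarith
  subst hs hm
  by_contra hq
  push Not at hq
  nlinarith

lemma exists_level (C : ℝ) (hC : 0 < C) (n : ℕ) (hn : 2 ≤ n) :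
    ∃ L : ℕ, (n : ℝ) ^ C ≤ 2 ^ L ∧ (L : ℝ) ≤ 2 * (C + 1) * Real.log n := by
  have hn' : (2 : ℝ) ≤ n := by exact_mod_cast hn
  have hl2 := Real.log_two_gt_d9
  have hln : Real.log 2 ≤ Real.log n := Real.log_le_log (by norm_num) hn'
  refine ⟨⌈C * Real.log n / Real.log 2⌉₊, ?_, ?_⟩
  · have h := Nat.le_ceil (C * Real.log n / Real.log 2)
    rw [div_le_iff₀ (by linarith)] at h
    rw [← Real.log_le_log_iff (by positivity) (by positivity), Real.log_rpow (by linarith),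
      Real.log_pow]
    exact h
  · have h := (Nat.ceil_lt_add_one (a := C * Real.log n / Real.log 2)
      (div_nonneg (mul_nonneg hC.le (by linarith)) (by linarith))).le
    have h2 : C * Real.log n / Real.log 2 ≤ 2 * C * Real.log n := by
      rw [div_le_iff₀ (by linarith)]
      have : 0 < C * Real.log n := mul_pos hC (by linarith)
      nlinarith
    nlinarith

lemma exists_threshold {n d : ℕ} (μ : Fin n → ℝ) (v : Fin n → EuclideanSpace ℝ (Fin d))
    (hμ : ∀ i, 0 < μ i) (M : ℝ) (hM0 : 0 < M) (L : ℕ)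
    (hL : ∀ i, M * ‖v i‖ ^ 2 ≤ 2 ^ L)
    (hq : 1 / 2 ≤ ∑ i ∈ univ.filter (fun i => ¬ ‖v i‖ ^ 2 ≤ 3 / M), μ i * ‖v i‖ ^ 2) :
    0 < L ∧ ∃ t : ℝ, 3 ≤ t ∧
      1 / (4 * (L : ℝ)) ≤ t / M * ∑ i ∈ univ.filter (fun i => ¬ ‖v i‖ ^ 2 ≤ t / M), μ i := by
  have key : ∑ i ∈ univ.filter (fun i => ¬ ‖v i‖ ^ 2 ≤ 3 / M), μ i * ‖v i‖ ^ 2 ≤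
      ∑ k ∈ range L, 2 * ((3 * 2 ^ k) / M *
        ∑ i ∈ univ.filter (fun i => ¬ ‖v i‖ ^ 2 ≤ (3 * 2 ^ k) / M), μ i) := by
    calc _ ≤ ∑ i ∈ univ.filter (fun i => ¬ ‖v i‖ ^ 2 ≤ 3 / M), μ i *
          ∑ k ∈ range L, if 3 / M * 2 ^ k < ‖v i‖ ^ 2 then 2 * (3 / M * 2 ^ k) else 0 := by
          refine Finset.sum_le_sum fun i hi => mul_le_mul_of_nonneg_left ?_ (hμ i).le
          refine dyadic_bound _ _ (by positivity) (not_le.mp (Finset.mem_filter.mp hi).2) _ ?_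
          rw [div_mul_eq_mul_div, le_div_iff₀ hM0]
          have := hL i
          have : (0 : ℝ) < 2 ^ L := by positivity
          linarith
      _ ≤ ∑ i, μ i *
          ∑ k ∈ range L, if 3 / M * 2 ^ k < ‖v i‖ ^ 2 then 2 * (3 / M * 2 ^ k) else 0 := by
          refine Finset.sum_le_sum_of_subset_of_nonneg (Finset.filter_subset _ _) fun i _ _ =>
            mul_nonneg (hμ i).le (Finset.sum_nonneg fun k _ => ?_)
          split_ifs <;> positivity
      _ = _ := by
          simp only [Finset.mul_sum]
          rw [Finset.sum_comm]
          refine Finset.sum_congr rfl fun k _ => ?_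
          rw [Finset.sum_filter]
          refine Finset.sum_congr rfl fun i _ => ?_
          have e : (3 : ℝ) / M * 2 ^ k = 3 * 2 ^ k / M := by ring
          rw [e]
          by_cases h : ‖v i‖ ^ 2 ≤ 3 * 2 ^ k / M
          · rw [if_neg (not_lt.mpr h), if_neg (not_not.mpr h)]; ring
          · rw [if_pos (not_le.mp h), if_pos h]; ring
  have hL0 : 0 < L := by
    rcases Nat.eq_zero_or_pos L with rfl | h
    · simp only [Finset.range_zero, Finset.sum_empty] at key; linarith
    · exact h
  refine ⟨hL0, ?_⟩
  have hLr : (0 : ℝ) < L := by exact_mod_cast hL0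
  by_contra hcon
  push Not at hcon
  have : ∑ k ∈ range L, 2 * ((3 * 2 ^ k) / M *
        ∑ i ∈ univ.filter (fun i => ¬ ‖v i‖ ^ 2 ≤ (3 * 2 ^ k) / M), μ i) <
      ∑ k ∈ range L, 2 * (1 / (4 * (L : ℝ))) := by
    refine Finset.sum_lt_sum_of_nonempty (Finset.nonempty_range_iff.mpr hL0.ne') fun k _ => ?_
    have h2 : (1 : ℝ) ≤ 2 ^ k := one_le_pow₀ (by norm_num)
    have := hcon (3 * 2 ^ k) (by linarith)
    simp only [not_le] at this ⊢
    linarith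
  rw [Finset.sum_const, Finset.card_range, nsmul_eq_mul] at this
  have e : (L : ℝ) * (2 * (1 / (4 * (L : ℝ)))) = 1 / 2 := by field_simp; norm_num
  linarith

lemma far_apart {E : Type*} [NormedAddCommGroup E] (x y : E) (s : ℝ)
    (hx : 2 * s < ‖x‖ ^ 2) (hy : ‖y‖ ^ 2 ≤ s) : (2 / 25) * ‖x‖ ^ 2 ≤ ‖x - y‖ ^ 2 := by
  have hb : ‖y‖ ≤ 0.71 * ‖x‖ := by
    refine abs_le_of_sq_le_sq' ?_ (by positivity) |>.2
    nlinarith [sq_nonneg ‖x‖]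
  have h := norm_sub_norm_le x y
  have h3 : 0.29 * ‖x‖ ≤ ‖x - y‖ := by linarith
  have := pow_le_pow_left₀ (by positivity) h3 2
  nlinarith [sq_nonneg ‖x‖]

/-- The claim with the additional information that `S = V ∖ R_t` is nonempty. -/
theorem strong_version :
    ∀ C : ℝ, 0 < C → ∃ c : ℝ, 0 < c ∧
      ∀ (n d : ℕ), 2 ≤ n →
        ∀ (μ : Fin n → ℝ) (v : Fin n → EuclideanSpace ℝ (Fin d)),
          (∀ i, 0 < μ i) →
          (∀ i, (n : ℝ) ^ (-C) ≤ μ i / ∑ j, μ j) →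
          ((∑ i, μ i • v i) = 0) →
          ((∑ i, μ i * ‖v i‖ ^ 2) = 1) →
          -- the embedding is not (3, 1/10)-balanced:
          ¬ ((1 / ∑ j, μ j) *
                ((1 : ℝ) / 2 *
                  ∑ i ∈ Finset.univ.filter fun i => ‖v i‖ ^ 2 ≤ 3 / ∑ j, μ j,
                    ∑ j ∈ Finset.univ.filter fun i => ‖v i‖ ^ 2 ≤ 3 / ∑ j, μ j,
                      (μ i * μ j / ∑ k, μ k) * ‖v i - v j‖ ^ 2) ≥
              (1 / 10) * ∑ i, (μ i / ∑ j, μ j) * ‖v i‖ ^ 2) →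
          ∃ t : ℝ, 3 ≤ t ∧
            (univ.filter fun i => ¬ ‖v i‖ ^ 2 ≤ t / ∑ j, μ j).Nonempty ∧
            -- `T = R_{3/2}` has measure at least `μ(V)/3`:
            ((1 : ℝ) / 3) * (∑ i, μ i) ≤
              (∑ i ∈ Finset.univ.filter fun i => ‖v i‖ ^ 2 ≤ (3 / 2) / ∑ j, μ j, μ i) ∧
            -- every `i ∈ S = V ∖ R_t` and `j ∈ T = R_{3/2}` are far apart:
            ∀ i ∈ Finset.univ.filter fun i => ¬ ‖v i‖ ^ 2 ≤ t / ∑ j, μ j,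
              ∀ j ∈ Finset.univ.filter fun i => ‖v i‖ ^ 2 ≤ (3 / 2) / ∑ j, μ j,
                (c / Real.log n) /
                    (∑ i ∈ Finset.univ.filter fun i => ¬ ‖v i‖ ^ 2 ≤ t / ∑ j, μ j, μ i) ≤
                  ‖v i - v j‖ ^ 2 := by
  intro C hC
  refine ⟨1 / (100 * (C + 1)), by positivity, ?_⟩
  intro n d hn μ v hμ hμn h0 h1 hbal
  have hn' : (2 : ℝ) ≤ n := by exact_mod_cast hn
  have hM0 : 0 < ∑ j, μ j :=
    Finset.sum_pos (fun i _ => hμ i) ⟨⟨0, by omega⟩, Finset.mem_univ _⟩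
  obtain ⟨M, hM⟩ : ∃ M, M = ∑ j, μ j := ⟨_, rfl⟩
  rw [← hM] at hM0
  simp only [← hM] at hμn hbal ⊢
  have hlog : 0 < Real.log n := Real.log_pos (by linarith)
  have hb : ∑ i ∈ univ.filter (fun i => ‖v i‖ ^ 2 ≤ 3 / M),
      ∑ j ∈ univ.filter (fun i => ‖v i‖ ^ 2 ≤ 3 / M), μ i * μ j * ‖v i - v j‖ ^ 2 < M / 5 := by
    have e1 : ∑ i, (μ i / M) * ‖v i‖ ^ 2 = 1 / M := by
      rw [← h1, Finset.sum_div]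
      exact Finset.sum_congr rfl fun i _ => by ring
    have e2 : ∑ i ∈ univ.filter (fun i => ‖v i‖ ^ 2 ≤ 3 / M),
        ∑ j ∈ univ.filter (fun i => ‖v i‖ ^ 2 ≤ 3 / M), (μ i * μ j / M) * ‖v i - v j‖ ^ 2 =
        (∑ i ∈ univ.filter (fun i => ‖v i‖ ^ 2 ≤ 3 / M),
      ∑ j ∈ univ.filter (fun i => ‖v i‖ ^ 2 ≤ 3 / M), μ i * μ j * ‖v i - v j‖ ^ 2) / M := by
      simp only [Finset.sum_div]
      exact Finset.sum_congr rfl fun i _ => Finset.sum_congr rfl fun j _ => by ring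
    rw [e1, e2, ge_iff_le, not_le] at hbal
    generalize (∑ i ∈ univ.filter (fun i => ‖v i‖ ^ 2 ≤ 3 / M),
      ∑ j ∈ univ.filter (fun i => ‖v i‖ ^ 2 ≤ 3 / M), μ i * μ j * ‖v i - v j‖ ^ 2) = X at *
    rw [mul_comm (1 / 10 : ℝ)] at hbal
    have h := lt_of_mul_lt_mul_left hbal (by positivity)
    have h' : X / M < 1 / 5 := by linarith
    rw [div_lt_iff₀ hM0] at h'
    linarith
  have hq := tail_half μ v hμ M hM hM0 h0 h1 hb
  obtain ⟨L, hL1, hL2⟩ := exists_level C hC n hn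
  have hL : ∀ i, M * ‖v i‖ ^ 2 ≤ 2 ^ L := by
    intro i
    refine le_trans ?_ hL1
    have h := hμn i
    have hi : μ i * ‖v i‖ ^ 2 ≤ 1 := by
      rw [← h1]
      exact Finset.single_le_sum (f := fun i => μ i * ‖v i‖ ^ 2)
        (fun j _ => mul_nonneg (hμ j).le (sq_nonneg _)) (Finset.mem_univ i)
    have hpos : (0 : ℝ) < (n : ℝ) ^ C := by positivity
    rw [Real.rpow_neg (by positivity), inv_le_comm₀ hpos (div_pos (hμ i) hM0), inv_div] at h
    refine le_trans ?_ h
    rw [le_div_iff₀ (hμ i)]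
    nlinarith
  obtain ⟨hL0, t, ht3, ht⟩ := exists_threshold μ v hμ M hM0 L hL hq
  have hLr : (0 : ℝ) < L := by exact_mod_cast hL0
  have hS : 0 < ∑ i ∈ univ.filter (fun i => ¬ ‖v i‖ ^ 2 ≤ t / M), μ i := by
    have : 0 < t / M := by positivity
    have h2 : 0 < 1 / (4 * (L : ℝ)) := by positivity
    exact pos_of_mul_pos_right (lt_of_lt_of_le h2 ht) this.le
  refine ⟨t, ht3, ?_, ?_, ?_⟩
  · by_contra hne
    rw [Finset.not_nonempty_iff_eq_empty] at hne
    rw [hne] at hS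
    simp at hS
  · have hmk := markov_weight μ v hμ h1 ((3 / 2) / M)
    have e2 := Finset.sum_filter_add_sum_filter_not univ (fun i => ‖v i‖ ^ 2 ≤ (3 / 2) / M) μ
    rw [div_mul_eq_mul_div, div_le_one hM0] at hmk
    linarith
  · intro i hi j hj
    have hi := not_le.mp (Finset.mem_filter.mp hi).2
    have hj := (Finset.mem_filter.mp hj).2
    have h2 : 2 * (3 / 2 / M) ≤ t / M := by
      rw [← mul_div_assoc]
      exact div_le_div_of_nonneg_right (by linarith) hM0.le
    have hf := far_apart (v i) (v j) _ (lt_of_le_of_lt h2 hi) hj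
    refine le_trans ?_ hf
    rw [div_le_iff₀ hS]
    have h3 : 1 / (4 * (2 * (C + 1) * Real.log n)) ≤ 1 / (4 * (L : ℝ)) :=
      one_div_le_one_div_of_le (by positivity) (by linarith)
    have e : 1 / (100 * (C + 1)) / Real.log n =
        (2 / 25) * (1 / (4 * (2 * (C + 1) * Real.log n))) := by
      field_simp; norm_num
    have h5 := (h3.trans ht).trans (mul_le_mul_of_nonneg_right hi.le hS.le)
    rw [e]
    linarith

/-- Rounding an unbalanced embedding: for every `C > 0` there is a
`c > 0` such that for all `n ≥ 2`, positive vertex weights `μ` with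
`μ_i/μ(V) ≥ n^{−C}`, and embedding `{v_i} ⊆ ℝ^d` with `∑ μ_i v_i = 0` and
`∑ μ_i ‖v_i‖² = 1`, if the embedding is not `(3, 1/10)`-balanced then for some `t ≥ 3`
the set `S = V ∖ R_t` is `(c / log n, 1/3)`-robustly separated, witnessed by
`T = R_{3/2}`, where `R_t = {i : ‖v_i‖² ≤ t/μ(V)}`. -/
theorem unbalanced_embedding_robustly_separated_sweep_cut :
    ∀ C : ℝ, 0 < C → ∃ c : ℝ, 0 < c ∧
      ∀ (n d : ℕ), 2 ≤ n →
        ∀ (μ : Fin n → ℝ) (v : Fin n → EuclideanSpace ℝ (Fin d)),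
          (∀ i, 0 < μ i) →
          (∀ i, (n : ℝ) ^ (-C) ≤ μ i / ∑ j, μ j) →
          ((∑ i, μ i • v i) = 0) →
          ((∑ i, μ i * ‖v i‖ ^ 2) = 1) →
          -- the embedding is not (3, 1/10)-balanced:
          ¬ ((1 / ∑ j, μ j) *
                ((1 : ℝ) / 2 *
                  ∑ i ∈ Finset.univ.filter fun i => ‖v i‖ ^ 2 ≤ 3 / ∑ j, μ j,
                    ∑ j ∈ Finset.univ.filter fun i => ‖v i‖ ^ 2 ≤ 3 / ∑ j, μ j,
                      (μ i * μ j / ∑ k, μ k) * ‖v i - v j‖ ^ 2) ≥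
              (1 / 10) * ∑ i, (μ i / ∑ j, μ j) * ‖v i‖ ^ 2) →
          ∃ t : ℝ, 3 ≤ t ∧
            -- `T = R_{3/2}` has measure at least `μ(V)/3`:
            ((1 : ℝ) / 3) * (∑ i, μ i) ≤
              (∑ i ∈ Finset.univ.filter fun i => ‖v i‖ ^ 2 ≤ (3 / 2) / ∑ j, μ j, μ i) ∧
            -- every `i ∈ S = V ∖ R_t` and `j ∈ T = R_{3/2}` are far apart:
            ∀ i ∈ Finset.univ.filter fun i => ¬ ‖v i‖ ^ 2 ≤ t / ∑ j, μ j,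
              ∀ j ∈ Finset.univ.filter fun i => ‖v i‖ ^ 2 ≤ (3 / 2) / ∑ j, μ j,
                (c / Real.log n) /
                    (∑ i ∈ Finset.univ.filter fun i => ¬ ‖v i‖ ^ 2 ≤ t / ∑ j, μ j, μ i) ≤
                  ‖v i - v j‖ ^ 2 := by
  intro C hC
  obtain ⟨c, hc, h⟩ := strong_version C hC
  refine ⟨c, hc, fun n d hn μ v hμ hμn h0 h1 hb => ?_⟩
  obtain ⟨t, ht, _, h2⟩ := h n d hn μ v hμ hμn h0 h1 hb
  exact ⟨t, ht, h2⟩
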